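/- There exists an absolute constant C > 0 such that for every 1 ≤ p ≤ ∞, r > 1, every real sequence β̄ = (β_k), and every n ∈ ℕ, one has | n^r Ẽ_n(W^r_{β̄,1})_{L_p} − (2^{1−1/p}/π^{1+1/p}) ‖cos t‖_p^2 | ≤ C ( 1/n + e^{−r/(n+1)} (1 + n/(r−1)) ). -/

import Mathlib

open MeasureTheory Real Set
open scoped ENNReal

/-- The `L_p` "norm" of a (2π-periodic) function over one period `(0, 2π]`. -/
noncomputable def LpNormPer (p : ℝ≥0∞) (f : ℝ → ℝ) : ℝ :=
  (eLpNorm f p (volume.restrict (Ioc (0:ℝ) (2*π)))).toReal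

/-- `‖cos t‖_p` over one period. -/
noncomputable def cosLp (p : ℝ≥0∞) : ℝ := LpNormPer p Real.cos

/-- `T` is a trigonometric polynomial of order (degree) at most `m`. -/
def IsTrigPolyDeg (m : ℕ) (T : ℝ → ℝ) : Prop :=
  ∃ a b : ℕ → ℝ, ∀ x : ℝ, T x = a 0 / 2 +
    ∑ k ∈ Finset.Icc 1 m, (a k * Real.cos (k * x) + b k * Real.sin (k * x))

/-- Admissible `φ`: 2π-periodic, integrable on a period, `φ ⊥ 1`, `‖φ‖₁ ≤ 1`. -/
def AdmPhi (φ : ℝ → ℝ) : Prop :=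
  (∀ t : ℝ, φ (t + 2*π) = φ t) ∧ IntegrableOn φ (Ioc (0:ℝ) (2*π)) volume ∧
  (∫ t in (0:ℝ)..(2*π), φ t) = 0 ∧ (∫ t in (0:ℝ)..(2*π), |φ t|) ≤ 1

/-- The generating kernel `Ψ_β̄(t) = Σ_{k≥1} ψ(k) cos(kt − πβ_k/2)`. -/
noncomputable def ker1 (ψ βb : ℕ → ℝ) (t : ℝ) : ℝ :=
  ∑' k : ℕ, ψ (k+1) * Real.cos ((k+1 : ℝ) * t - π * βb (k+1) / 2)

/-- The class `C^ψ_{β̄,1}` of convolutions `f = a₀/2 + (1/π) Ψ_β̄ * φ`. -/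
def ClassC (ψ βb : ℕ → ℝ) : Set (ℝ → ℝ) :=
  { f | ∃ a₀ : ℝ, ∃ φ : ℝ → ℝ, AdmPhi φ ∧
      ∀ x : ℝ, f x = a₀ / 2 + (1/π) * ∫ t in (0:ℝ)..(2*π), ker1 ψ βb (x - t) * φ t }

/-- `T` is the interpolation trigonometric polynomial `S̃_{n-1}(f)` of `f` at the
equidistant nodes `x_k^{(n-1)} = 2kπ/(2n-1)`. -/
def InterpolatesAt (n : ℕ) (T f : ℝ → ℝ) : Prop :=
  IsTrigPolyDeg (n - 1) T ∧
  ∀ k : ℤ, T (2 * (k:ℝ) * π / (2 * (n:ℝ) - 1)) = f (2 * (k:ℝ) * π / (2 * (n:ℝ) - 1))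

/-- `Ẽ_n(F)_{L_p} = sup_{f ∈ F} ‖f − S̃_{n-1}(f;·)‖_p`. -/
noncomputable def interpErr (p : ℝ≥0∞) (n : ℕ) (F : Set (ℝ → ℝ)) : ℝ :=
  sSup { e : ℝ | ∃ f ∈ F, ∃ T : ℝ → ℝ, InterpolatesAt n T f ∧
    e = LpNormPer p (fun x => f x - T x) }

lemma memLp_cont {f : ℝ → ℝ} (hf : Continuous f) (p : ℝ≥0∞) :
    MemLp f p (volume.restrict (Ioc (0:ℝ) (2*π))) := by
  obtain ⟨C, hC⟩ := (isCompact_Icc (a := (0:ℝ)) (b := 2*π)).exists_bound_of_continuousOn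
    hf.continuousOn
  refine MemLp.of_bound hf.aestronglyMeasurable C ?_
  refine (ae_restrict_iff' measurableSet_Ioc).2 (ae_of_all _ fun x hx => hC x ⟨hx.1.le, hx.2⟩)

lemma LpNormPer_eq {f : ℝ → ℝ} (hf : Continuous f) (p : ℝ≥0∞) :
    LpNormPer p f = lpNorm f p (volume.restrict (Ioc (0:ℝ) (2*π))) :=
  toReal_eLpNorm hf.aestronglyMeasurable

lemma two_pi_ge_one : (1:ℝ) ≤ 2*π := by have := Real.pi_gt_three; linarith

lemma LpNormPer_le_bound {p : ℝ≥0∞} (hp : 1 ≤ p) {f : ℝ → ℝ} {M : ℝ} (hM : 0 ≤ M)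
    (h : ∀ x, |f x| ≤ M) : LpNormPer p f ≤ 2*π*M := by
  unfold LpNormPer
  have h1 := eLpNorm_le_of_ae_bound (p := p) (f := f) (C := M)
    (μ := volume.restrict (Ioc (0:ℝ) (2*π))) (ae_of_all _ h)
  have h2 : (volume.restrict (Ioc (0:ℝ) (2*π))) univ ^ p.toReal⁻¹ * ENNReal.ofReal M
      ≤ ENNReal.ofReal (2*π*M) := by
    rw [ENNReal.ofReal_mul (by positivity)]
    gcongr
    simp only [Measure.restrict_apply_univ, Real.volume_Ioc, sub_zero]
    have : p.toReal⁻¹ ≤ 1 := by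
      by_cases hpt : p = ∞
      · simp [hpt]
      · apply inv_le_one_of_one_le₀
        have := ENNReal.toReal_mono hpt hp
        simpa using this
    calc ENNReal.ofReal (2*π) ^ p.toReal⁻¹ ≤ ENNReal.ofReal (2*π) ^ (1:ℝ) := by
          apply ENNReal.rpow_le_rpow_of_exponent_le _ this
          rw [← ENNReal.ofReal_one]
          exact ENNReal.ofReal_le_ofReal two_pi_ge_one
      _ = _ := by simp
  have h3 := ENNReal.toReal_mono (by simp) (h1.trans h2)
  rwa [ENNReal.toReal_ofReal (by positivity)] at h3

lemma LpNormPer_nonneg (p : ℝ≥0∞) (f : ℝ → ℝ) : 0 ≤ LpNormPer p f := ENNReal.toReal_nonneg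

lemma LpNormPer_close {p : ℝ≥0∞} (hp : 1 ≤ p) {f g : ℝ → ℝ} (hf : Continuous f)
    (hg : Continuous g) {M : ℝ} (hM : 0 ≤ M) (h : ∀ x, |f x - g x| ≤ M) :
    LpNormPer p f ≤ LpNormPer p g + 2*π*M := by
  have h1 : LpNormPer p f ≤ LpNormPer p g + LpNormPer p (fun x => f x - g x) := by
    rw [LpNormPer_eq hf, LpNormPer_eq hg, LpNormPer_eq (by fun_prop)]
    have := lpNorm_add_le (memLp_cont hg p) hp (g := fun x => f x - g x)
    convert this using 2
    ext x; simp
  linarith [LpNormPer_le_bound hp hM h]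

lemma LpNormPer_smul {p : ℝ≥0∞} {f : ℝ → ℝ} (c : ℝ) :
    LpNormPer p (fun x => c * f x) = |c| * LpNormPer p f := by
  unfold LpNormPer
  have := eLpNorm_const_smul c f p (volume.restrict (Ioc (0:ℝ) (2*π)))
  have h2 : (fun x => c * f x) = c • f := by ext; simp
  rw [h2, this, ENNReal.toReal_mul]; simp

lemma LpNormPer_top_ge {f : ℝ → ℝ} (hf : Continuous f) {x₀ : ℝ} (h0 : 0 < x₀) (h1 : x₀ < 2*π) :
    |f x₀| ≤ LpNormPer ∞ f := by
  by_contra hlt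
  push Not at hlt
  have h2 := ae_le_lpNorm_exponent_top (memLp_cont hf ∞)
  rw [← LpNormPer_eq hf] at h2
  rw [ae_restrict_iff' measurableSet_Ioc] at h2
  have hop : IsOpen ({x | LpNormPer ∞ f < |f x|} ∩ Ioo 0 (2*π)) :=
    (isOpen_lt continuous_const (by fun_prop)).inter isOpen_Ioo
  have := hop.measure_pos volume ⟨x₀, hlt, h0, h1⟩
  refine absurd ?_ this.ne'
  refine measure_mono_null ?_ h2
  rintro x ⟨hx, hx2⟩
  simp only [mem_compl_iff, mem_ofPred_eq, not_forall, not_le]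
  exact ⟨⟨hx2.1, hx2.2.le⟩, hx⟩

lemma LpNormPer_rpow {p : ℝ≥0∞} (hp : 1 ≤ p) (hpt : p ≠ ∞) {f : ℝ → ℝ} (hf : Continuous f) :
    LpNormPer p f = (∫ x in (0:ℝ)..(2*π), |f x| ^ p.toReal) ^ (p.toReal)⁻¹ := by
  rw [LpNormPer_eq hf, lpNorm_eq_integral_norm_rpow_toReal (by positivity) hpt
    hf.aestronglyMeasurable, intervalIntegral.integral_of_le (by positivity)]
  rfl

/-- main profile -/
noncomputable def prof (n : ℕ) (c x : ℝ) : ℝ := sin ((2*n-1)*x/2) * sin (x/2 - c)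

lemma prof_cont (n : ℕ) (c : ℝ) : Continuous (prof n c) := by unfold prof; fun_prop

lemma prof_le (n : ℕ) (c x : ℝ) : |prof n c x| ≤ 1 := by
  unfold prof; rw [abs_mul]
  exact mul_le_one₀ (abs_sin_le_one _) (abs_nonneg _) (abs_sin_le_one _)

lemma prof_lip (n : ℕ) (c c' x : ℝ) : |prof n c x - prof n c' x| ≤ |c - c'| := by
  unfold prof; rw [← mul_sub, abs_mul]
  have h1 : |sin (x/2 - c) - sin (x/2 - c')| ≤ |c - c'| := by
    have := Real.abs_sin_sub_sin_le (x/2-c) (x/2-c')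
    rw [abs_sub_comm c]
    convert this using 2; ring
  calc _ ≤ 1 * |c - c'| := by
        apply mul_le_mul (abs_sin_le_one _) h1 (abs_nonneg _) zero_le_one
    _ = _ := one_mul _

lemma abs_sin_per (q : ℝ) : Function.Periodic (fun x => |sin x| ^ q) π := by
  intro x; simp [sin_add_pi]

lemma cont_abs_sin (q : ℝ) (hq : 0 ≤ q) : Continuous (fun x => |sin x| ^ q) :=
  (continuous_sin.abs).rpow_const (fun _ => Or.inr hq)

lemma int_cos (q : ℝ) (hq : 0 ≤ q) :
    ∫ x in (0:ℝ)..(2*π), |cos x| ^ q = 2 * ∫ x in (0:ℝ)..π, |sin x| ^ q := by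
  have h1 : ∫ x in (0:ℝ)..(2*π), |cos x| ^ q = ∫ x in (0:ℝ)..(2*π), |sin (x + π/2)| ^ q := by
    simp [sin_add_pi_div_two]
  rw [h1, intervalIntegral.integral_comp_add_right (fun x => |sin x|^q)]
  have := (abs_sin_per q).intervalIntegral_add_zsmul_eq 2 (π/2)
    (fun _ _ => (cont_abs_sin q hq).intervalIntegrable _ _)
  rw [(abs_sin_per q).intervalIntegral_add_eq (π/2) 0] at this
  simp only [zsmul_eq_mul, zero_add] at this
  rw [zero_add, add_comm (2*π)]
  simpa using this

lemma int_sinN (q : ℝ) (hq : 0 ≤ q) (n : ℕ) (hn : 1 ≤ n) :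
    ∫ x in (0:ℝ)..(2*π), |sin ((2*n-1)*x/2)| ^ q = 2 * ∫ x in (0:ℝ)..π, |sin x| ^ q := by
  have hn' : (1:ℝ) ≤ n := by exact_mod_cast hn
  have hN : ((2:ℝ)*n-1)/2 ≠ 0 := by intro h; linarith
  have h1 : ∀ x:ℝ, (2*(n:ℝ)-1)*x/2 = ((2*(n:ℝ)-1)/2) * x := fun x => by ring
  simp_rw [h1]
  rw [intervalIntegral.integral_comp_mul_left (fun x => |sin x|^q) hN]
  have := (abs_sin_per q).intervalIntegral_add_zsmul_eq (2*n-1) 0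
    (fun _ _ => (cont_abs_sin q hq).intervalIntegrable _ _)
  simp only [zsmul_eq_mul, zero_add] at this
  push_cast at this
  have h2 : ((2:ℝ)*n-1)/2 * (2*π) = (2*n-1)*π := by ring
  rw [mul_zero, h2, this, smul_eq_mul, ← mul_assoc]
  congr 1
  field_simp
  exact div_self (fun h => by linarith)

lemma J_per (q : ℝ) (n : ℕ) (hn : 1 ≤ n) :
    Function.Periodic (fun c => ∫ x in (0:ℝ)..(2*π), |prof n c x| ^ q) (π/(2*n-1)) := by
  have hn' : (1:ℝ) ≤ n := by exact_mod_cast hn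
  have hN : ((2:ℝ)*n-1) ≠ 0 := by intro h; linarith
  intro c
  have h1 : ∀ x, |prof n (c + π/(2*n-1)) x| ^ q
      = (fun y => |prof n c y| ^ q) (x - 2*π/(2*n-1)) := by
    intro x
    simp only [prof]
    have e1 : (2*(n:ℝ)-1)*(x - 2*π/(2*n-1))/2 = (2*(n:ℝ)-1)*x/2 - π := by field_simp
    have e2 : (x - 2*π/(2*n-1))/2 - c = x/2 - (c + π/(2*n-1)) := by ring
    rw [e1, e2, sin_sub_pi]; simp
  simp_rw [h1]
  rw [intervalIntegral.integral_comp_sub_right (fun y => |prof n c y| ^ q)]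
  have hper : Function.Periodic (fun y => |prof n c y| ^ q) (2*π) := by
    intro y
    simp only [prof]
    have e1 : (2*(n:ℝ)-1)*(y + 2*π)/2 = (2*(n:ℝ)-1)*y/2 + n*(2*π) - π := by ring
    have e2 : (y + 2*π)/2 - c = (y/2 - c) + π := by ring
    rw [e1, e2, sin_sub_pi, sin_add_nat_mul_two_pi, sin_add_pi]; simp
  have := hper.intervalIntegral_add_eq (0 - 2*π/(2*n-1)) 0
  rw [zero_add] at this
  rw [← this]; congr 1; ring

lemma J_cont (q : ℝ) (hq : 0 ≤ q) (n : ℕ) :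
    Continuous (fun c => ∫ x in (0:ℝ)..(2*π), |prof n c x| ^ q) := by
  apply intervalIntegral.continuous_parametric_intervalIntegral_of_continuous'
  have : Continuous (Function.uncurry (prof n)) := by unfold prof Function.uncurry; fun_prop
  exact (this.abs).rpow_const (fun _ => Or.inr hq)

lemma J_int (q : ℝ) (hq : 0 ≤ q) (n : ℕ) (hn : 1 ≤ n) :
    ∫ c in (0:ℝ)..π, ∫ x in (0:ℝ)..(2*π), |prof n c x| ^ q
      = 2 * (∫ x in (0:ℝ)..π, |sin x| ^ q)^2 := by
  have hc : Continuous (Function.uncurry (fun c x => |prof n c x| ^ q)) := by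
    have : Continuous (Function.uncurry (prof n)) := by unfold prof Function.uncurry; fun_prop
    exact (this.abs).rpow_const (fun _ => Or.inr hq)
  have hsw : ∫ c in (0:ℝ)..π, ∫ x in (0:ℝ)..(2*π), |prof n c x| ^ q
      = ∫ x in (0:ℝ)..(2*π), ∫ c in (0:ℝ)..π, |prof n c x| ^ q := by
    rw [intervalIntegral.integral_of_le (a := 0) (b := 2*π) (by positivity)]
    simp_rw [intervalIntegral.integral_of_le (a := 0) (b := 2*π) two_pi_pos.le]
    apply intervalIntegral_integral_swap
    rw [Measure.prod_restrict, uIoc_of_le pi_pos.le]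
    refine IntegrableOn.mono_set (t := Icc 0 π ×ˢ Icc 0 (2*π)) ?_
      (prod_mono Ioc_subset_Icc_self Ioc_subset_Icc_self)
    exact hc.continuousOn.integrableOn_compact (isCompact_Icc.prod isCompact_Icc)
  rw [hsw]
  have hin : ∀ x, ∫ c in (0:ℝ)..π, |prof n c x| ^ q
      = |sin ((2*n-1)*x/2)| ^ q * ∫ x in (0:ℝ)..π, |sin x| ^ q := by
    intro x
    simp only [prof, abs_mul]
    simp_rw [Real.mul_rpow (abs_nonneg _) (abs_nonneg _)]
    rw [intervalIntegral.integral_const_mul]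
    congr 1
    rw [intervalIntegral.integral_comp_sub_left (fun y => |sin y| ^ q)]
    have := (abs_sin_per q).intervalIntegral_add_eq (x/2 - π) 0
    rw [zero_add] at this
    rw [← this]; congr 1; ring
  simp_rw [hin]
  rw [intervalIntegral.integral_mul_const, int_sinN q hq n hn]
  ring

/-- the limiting constant -/
noncomputable def Aconst (p : ℝ≥0∞) : ℝ := (2*π) ^ (-(1/p.toReal)) * (cosLp p)^2

lemma Aconst_eq (p : ℝ≥0∞) :
    2 ^ ((1:ℝ) - 1/p.toReal) / π ^ ((1:ℝ) + 1/p.toReal) * (cosLp p) ^ 2 = 2/π * Aconst p := by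
  unfold Aconst
  rw [Real.rpow_neg (by positivity), Real.mul_rpow (by norm_num) pi_pos.le,
    Real.rpow_sub (by norm_num), Real.rpow_add pi_pos, Real.rpow_one, Real.rpow_one]
  field_simp

lemma cosLp_top : cosLp ∞ = 1 := by
  unfold cosLp
  apply le_antisymm
  · have h1 : eLpNorm cos ∞ (volume.restrict (Ioc (0:ℝ) (2*π))) ≤ ENNReal.ofReal 1 := by
      have := eLpNorm_le_of_ae_bound (p := ∞) (f := cos) (C := 1)
        (μ := volume.restrict (Ioc (0:ℝ) (2*π))) (ae_of_all _ (fun x => abs_cos_le_one x))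
      simpa using this
    have := ENNReal.toReal_mono (by simp) h1
    simpa [LpNormPer] using this
  · have := LpNormPer_top_ge continuous_cos pi_pos (by linarith [pi_pos])
    simpa using this

lemma Aconst_top : Aconst ∞ = 1 := by simp [Aconst, cosLp_top]

lemma prof_fin {p : ℝ≥0∞} (hp : 1 ≤ p) (hpt : p ≠ ∞) {n : ℕ} (hn : 1 ≤ n) {c : ℝ}
    (hc : ∫ x in (0:ℝ)..(2*π), |prof n c x| ^ p.toReal
      = 2/π * (∫ x in (0:ℝ)..π, |sin x| ^ p.toReal)^2) :
    LpNormPer p (prof n c) = Aconst p := by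
  have hq1 : 1 ≤ p.toReal := by simpa using ENNReal.toReal_mono hpt hp
  set q := p.toReal
  set I := ∫ x in (0:ℝ)..π, |sin x| ^ q with hI
  have hI0 : 0 ≤ I := intervalIntegral.integral_nonneg pi_pos.le (fun x _ => by positivity)
  rw [LpNormPer_rpow hp hpt (prof_cont n c), hc, Aconst, cosLp,
    LpNormPer_rpow hp hpt continuous_cos, int_cos _ (by positivity)]
  change (2/π*I^2)^q⁻¹ = (2*π)^(-(1/q)) * ((2*I)^q⁻¹)^2
  have e : 2/π*I^2 = (2*π)⁻¹ * (2*I)^2 := by field_simp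
  rw [e, Real.mul_rpow (by positivity) (by positivity), Real.inv_rpow (by positivity),
    Real.rpow_neg (by positivity), one_div]
  congr 1
  rw [← Real.rpow_natCast, ← Real.rpow_natCast, ← Real.rpow_mul (by positivity),
    ← Real.rpow_mul (by positivity), mul_comm (q⁻¹)]

lemma exists_prof_fin {p : ℝ≥0∞} (hp : 1 ≤ p) (hpt : p ≠ ∞) {n : ℕ} (hn : 1 ≤ n) :
    ∃ c, ∫ x in (0:ℝ)..(2*π), |prof n c x| ^ p.toReal
      = 2/π * (∫ x in (0:ℝ)..π, |sin x| ^ p.toReal)^2 := by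
  have hq : 0 ≤ p.toReal := ENNReal.toReal_nonneg
  obtain ⟨c, -, hc⟩ := exists_eq_interval_average (a := 0) (b := π) pi_pos.ne
    (J_cont p.toReal hq n).continuousOn
  refine ⟨c, ?_⟩
  rw [hc, interval_average_eq, J_int _ hq n hn, smul_eq_mul]
  field_simp; ring

lemma exists_prof {p : ℝ≥0∞} (hp : 1 ≤ p) {n : ℕ} (hn : 1 ≤ n) :
    ∃ c, Aconst p ≤ LpNormPer p (prof n c) := by
  by_cases hpt : p = ∞
  · subst hpt
    have hn' : (1:ℝ) ≤ n := by exact_mod_cast hn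
    have hN : (0:ℝ) < 2*n-1 := by linarith
    refine ⟨π/(2*n-1)/2 - π/2, ?_⟩
    rw [Aconst_top]
    have := LpNormPer_top_ge (prof_cont n (π/(2*n-1)/2 - π/2)) (x₀ := π/(2*n-1)) (by positivity)
      (by rw [div_lt_iff₀ hN]; nlinarith [pi_pos])
    refine le_trans (le_of_eq ?_) this
    unfold prof
    have e1 : (2*(n:ℝ)-1)*(π/(2*n-1))/2 = π/2 := by field_simp
    rw [e1]; simp
  · obtain ⟨c, hc⟩ := exists_prof_fin hp hpt hn
    exact ⟨c, (prof_fin hp hpt hn hc).ge⟩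

lemma prof_upper {p : ℝ≥0∞} (hp : 1 ≤ p) {n : ℕ} (hn : 1 ≤ n) (c : ℝ) :
    LpNormPer p (prof n c) ≤ Aconst p + 2*π*(π/n) := by
  have hn' : (1:ℝ) ≤ n := by exact_mod_cast hn
  have hN : (0:ℝ) < 2*n-1 := by linarith
  by_cases hpt : p = ∞
  · subst hpt
    rw [Aconst_top]
    have h1 : eLpNorm (prof n c) ∞ (volume.restrict (Ioc (0:ℝ) (2*π))) ≤ ENNReal.ofReal 1 := by
      have := eLpNorm_le_of_ae_bound (p := ∞) (f := prof n c) (C := 1)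
        (μ := volume.restrict (Ioc (0:ℝ) (2*π))) (ae_of_all _ (fun x => prof_le n c x))
      simpa using this
    have h2 := ENNReal.toReal_mono (by simp) h1
    have h3 : LpNormPer ∞ (prof n c) ≤ 1 := by simpa [LpNormPer] using h2
    have : 0 ≤ 2*π*(π/n) := by positivity
    linarith
  · obtain ⟨c₀, hc₀⟩ := exists_prof_fin hp hpt hn
    obtain ⟨c₁, hc₁, he⟩ := (J_per p.toReal n hn).exists_mem_Ico (by positivity) c₀ c
    have h1 := prof_fin hp hpt hn (he.symm.trans hc₀)
    rw [← h1]
    apply LpNormPer_close hp (prof_cont _ _) (prof_cont _ _) (by positivity)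
    intro x
    refine (prof_lip _ _ _ _).trans ?_
    rw [abs_sub_comm, abs_of_nonneg (by linarith [hc₁.1])]
    have : π/(2*n-1) ≤ π/n := by gcongr; linarith
    linarith [hc₁.2]

lemma Aconst_le {p : ℝ≥0∞} (hp : 1 ≤ p) : Aconst p ≤ 2*π := by
  obtain ⟨c, hc⟩ := exists_prof hp (le_refl 1)
  have := LpNormPer_le_bound hp zero_le_one (prof_le 1 c)
  linarith

lemma Aconst_nonneg (p : ℝ≥0∞) : 0 ≤ Aconst p := by unfold Aconst; positivity

lemma sum_nodes (N : ℕ) (hN : 0 < N) (q : ℤ) (c : ℝ) :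
    ∑ j ∈ Finset.range N, cos (q * (2 * (j:ℝ) * π / N) + c)
      = if (N:ℤ) ∣ q then N * cos c else 0 := by
  have hN0 : (N:ℂ) ≠ 0 := by exact_mod_cast hN.ne'
  set w : ℂ := Complex.exp (2 * π * Complex.I * q / N) with hw
  have hterm : ∀ j : ℕ, cos (q * (2 * (j:ℝ) * π / N) + c)
      = (Complex.exp (c * Complex.I) * w ^ j).re := by
    intro j
    rw [hw, ← Complex.exp_nat_mul, ← Complex.exp_add]
    have : (c:ℂ) * Complex.I + j * (2 * π * Complex.I * q / N)
        = ((q * (2 * (j:ℝ) * π / N) + c : ℝ) : ℂ) * Complex.I := by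
      push_cast; ring
    rw [this, Complex.exp_ofReal_mul_I_re]
  simp_rw [hterm]
  rw [← Complex.re_sum, ← Finset.mul_sum]
  have hwN : w ^ N = 1 := by
    rw [hw, ← Complex.exp_nat_mul, Complex.exp_eq_one_iff]
    exact ⟨q, by field_simp⟩
  have hw1 : w = 1 ↔ (N:ℤ) ∣ q := by
    rw [hw, Complex.exp_eq_one_iff]
    constructor
    · rintro ⟨m, hm⟩
      refine ⟨m, ?_⟩
      have h2 : (2 * π * Complex.I : ℂ) ≠ 0 := Complex.two_pi_I_ne_zero
      have h3 : (2 * π * Complex.I : ℂ) * q = (2 * π * Complex.I) * (N * m) := by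
        rw [div_eq_iff hN0] at hm; rw [hm]; ring
      have h4 := mul_left_cancel₀ h2 h3
      exact_mod_cast h4
    · rintro ⟨m, rfl⟩
      refine ⟨m, ?_⟩
      push_cast; field_simp
  split_ifs with h
  · rw [hw1.2 h]; simp only [one_pow, Finset.sum_const, Finset.card_range, nsmul_eq_mul, mul_one]
    rw [mul_comm, ← Complex.ofReal_natCast, Complex.re_ofReal_mul, Complex.exp_ofReal_mul_I_re]
  · rw [geom_sum_eq (fun h' => h (hw1.1 h')), hwN]; simp

noncomputable def nd (n : ℕ) (j : ℕ) : ℝ := 2 * (j:ℝ) * π / (2*(n:ℝ)-1)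

noncomputable def Sop (n : ℕ) (f : ℝ → ℝ) (x : ℝ) : ℝ :=
  (1/(2*(n:ℝ)-1)) * ∑ j ∈ Finset.range (2*n-1), ∑ l ∈ Finset.Icc (-((n:ℤ)-1)) ((n:ℤ)-1),
    f (nd n j) * cos (l * (x - nd n j))

/-- aliased frequency -/
def ali (n : ℕ) (k : ℤ) : ℤ := (k + (n-1)) % (2*n-1) - (n-1)

lemma ali_mem (n : ℕ) (hn : 1 ≤ n) (k : ℤ) :
    ali n k ∈ Finset.Icc (-((n:ℤ)-1)) ((n:ℤ)-1) := by
  have h0 : (0:ℤ) < 2*n-1 := by omega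
  have h1 := Int.emod_nonneg (k + (n-1)) h0.ne'
  have h2 := Int.emod_lt_of_pos (k + (n-1)) h0
  rw [Finset.mem_Icc]; unfold ali; constructor <;> linarith

lemma ali_dvd (n : ℕ) (k : ℤ) : (2*(n:ℤ)-1) ∣ k - ali n k := by
  unfold ali
  have := Int.dvd_self_sub_emod (x := k + (n-1)) (m := 2*(n:ℤ)-1)
  obtain ⟨c, hc⟩ := this
  exact ⟨c, by linarith⟩

lemma ali_unique (n : ℕ) (hn : 1 ≤ n) (k l : ℤ) (hl : l ∈ Finset.Icc (-((n:ℤ)-1)) ((n:ℤ)-1))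
    (h : (2*(n:ℤ)-1) ∣ k - l) : l = ali n k := by
  have h1 := ali_mem n hn k
  have h2 := ali_dvd n k
  rw [Finset.mem_Icc] at h1 hl
  have h3 : (2*(n:ℤ)-1) ∣ l - ali n k := by
    obtain ⟨u, hu⟩ := h2
    obtain ⟨v, hv⟩ := h
    exact ⟨u - v, by rw [mul_sub]; linarith⟩
  have h4 : l - ali n k = 0 := by
    apply Int.eq_zero_of_abs_lt_dvd h3
    rw [abs_lt]; constructor <;> linarith
  linarith

lemma sum_odd_zero (m : ℤ) (g : ℤ → ℝ) (hg : ∀ l, g (-l) = - g l) :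
    ∑ l ∈ Finset.Icc (-m) m, g l = 0 := by
  have h : ∑ l ∈ Finset.Icc (-m) m, g l = ∑ l ∈ Finset.Icc (-m) m, g (-l) := by
    refine Finset.sum_nbij' (fun l => -l) (fun l => -l) ?_ ?_ ?_ ?_ ?_
    · intro a ha; simp only [Finset.mem_Icc] at *; omega
    · intro a ha; simp only [Finset.mem_Icc] at *; omega
    · simp
    · simp
    · simp
  simp_rw [hg] at h
  rw [Finset.sum_neg_distrib] at h
  linarith

lemma Sop_cos (n : ℕ) (hn : 1 ≤ n) (k : ℤ) (γ x : ℝ) :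
    Sop n (fun y => cos (k * y - γ)) x = cos (ali n k * x - γ) := by
  have hn' : (1:ℝ) ≤ n := by exact_mod_cast hn
  have hN : ((2:ℝ)*n-1) ≠ 0 := by intro h; linarith
  have hcast : ((2*n-1 : ℕ) : ℝ) = 2*(n:ℝ)-1 := by
    rw [Nat.cast_sub (by omega)]; push_cast; ring
  have hcastZ : ((2*n-1 : ℕ) : ℤ) = 2*(n:ℤ)-1 := by
    rw [Nat.cast_sub (by omega)]; push_cast; ring
  unfold Sop
  have h1 : ∀ j : ℕ, ∑ l ∈ Finset.Icc (-((n:ℤ)-1)) ((n:ℤ)-1),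
      cos (k * nd n j - γ) * cos (l * (x - nd n j))
      = ∑ l ∈ Finset.Icc (-((n:ℤ)-1)) ((n:ℤ)-1),
        cos (((k - l : ℤ):ℝ) * (2 * (j:ℝ) * π / (2*n-1 : ℕ)) + (l * x - γ)) := by
    intro j
    have h2 := sum_odd_zero ((n:ℤ)-1) (fun l => sin (k * nd n j - γ) * sin (l * (x - nd n j)))
      (by intro l; push_cast; rw [neg_mul, sin_neg]; ring)
    rw [← sub_zero (∑ l ∈ Finset.Icc (-((n:ℤ)-1)) ((n:ℤ)-1), _), ← h2, ← Finset.sum_sub_distrib]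
    refine Finset.sum_congr rfl fun l _ => ?_
    rw [← cos_add, hcast]
    congr 1
    unfold nd; push_cast; ring
  simp_rw [h1]
  rw [Finset.sum_comm]
  simp_rw [sum_nodes (2*n-1) (by omega), hcastZ]
  rw [Finset.sum_eq_single (ali n k)]
  · rw [if_pos (ali_dvd n k), hcast]; field_simp
  · intro l hl hne
    rw [if_neg]
    intro h; exact hne (ali_unique n hn k l hl h)
  · intro h; exact absurd (ali_mem n hn k) h

lemma ali_small (n : ℕ) (hn : 1 ≤ n) (k : ℕ) (hk : k < n) : ali n k = k := by
  symm
  apply ali_unique n hn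
  · rw [Finset.mem_Icc]; omega
  · simp

lemma ali_n (n : ℕ) (hn : 1 ≤ n) : ali n n = -((n:ℤ)-1) := by
  symm
  apply ali_unique n hn
  · rw [Finset.mem_Icc]; omega
  · exact ⟨1, by ring⟩

lemma Sop_add (n : ℕ) (f g : ℝ → ℝ) (x : ℝ) :
    Sop n (fun y => f y + g y) x = Sop n f x + Sop n g x := by
  unfold Sop
  rw [← mul_add, ← Finset.sum_add_distrib]
  simp_rw [← Finset.sum_add_distrib, add_mul]

lemma Sop_smul (n : ℕ) (a : ℝ) (f : ℝ → ℝ) (x : ℝ) :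
    Sop n (fun y => a * f y) x = a * Sop n f x := by
  unfold Sop
  simp_rw [mul_assoc, ← Finset.mul_sum]
  ring

lemma Sop_sum {ι : Type*} (n : ℕ) (s : Finset ι) (f : ι → ℝ → ℝ) (x : ℝ) :
    Sop n (fun y => ∑ i ∈ s, f i y) x = ∑ i ∈ s, Sop n (f i) x := by
  classical
  induction s using Finset.induction_on with
  | empty => simp [Sop]
  | insert a s ha ih => simp only [Finset.sum_insert ha]; rw [Sop_add, ih]

lemma Sop_const (n : ℕ) (hn : 1 ≤ n) (a : ℝ) (x : ℝ) : Sop n (fun _ => a) x = a := by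
  have h := Sop_cos n hn 0 0 x
  have h2 := ali_small n hn 0 (by omega)
  simp only [Nat.cast_zero] at h2
  rw [h2] at h
  have h3 := Sop_smul n a (fun y => cos ((0:ℤ) * y - 0)) x
  rw [h] at h3
  simpa using h3

lemma Sop_trig (n : ℕ) (hn : 1 ≤ n) {T : ℝ → ℝ} (hT : IsTrigPolyDeg (n-1) T) (x : ℝ) :
    Sop n T x = T x := by
  obtain ⟨a, b, hab⟩ := hT
  have hT' : T = fun y => a 0 / 2 +
    ∑ k ∈ Finset.Icc 1 (n-1), (a k * Real.cos (k * y) + b k * Real.sin (k * y)) := funext hab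
  rw [hab x, hT', Sop_add, Sop_const n hn, Sop_sum]
  congr 1
  refine Finset.sum_congr rfl fun k hk => ?_
  rw [Finset.mem_Icc] at hk
  have hk' := ali_small n hn k (by omega)
  rw [Sop_add, Sop_smul, Sop_smul]
  have h1 := Sop_cos n hn k 0 x
  have h2 := Sop_cos n hn k (π/2) x
  rw [hk'] at h1 h2
  simp only [sub_zero, cos_sub_pi_div_two, Int.cast_natCast] at h1 h2
  rw [h1, h2]

lemma Sop_congr (n : ℕ) (f g : ℝ → ℝ) (h : ∀ j : ℕ, f (nd n j) = g (nd n j)) (x : ℝ) :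
    Sop n f x = Sop n g x := by
  unfold Sop; simp_rw [h]

lemma interp_eq (n : ℕ) (hn : 1 ≤ n) {T f : ℝ → ℝ} (h : InterpolatesAt n T f) (x : ℝ) :
    T x = Sop n f x := by
  rw [← Sop_trig n hn h.1 x]
  apply Sop_congr
  intro j
  have := h.2 j
  simpa [nd] using this

lemma trig_add {m : ℕ} {f g : ℝ → ℝ} (hf : IsTrigPolyDeg m f) (hg : IsTrigPolyDeg m g) :
    IsTrigPolyDeg m (fun x => f x + g x) := by
  obtain ⟨a, b, h⟩ := hf
  obtain ⟨a', b', h'⟩ := hg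
  refine ⟨fun k => a k + a' k, fun k => b k + b' k, fun x => ?_⟩
  simp only [h, h']
  have : ∑ k ∈ Finset.Icc 1 m, ((a k + a' k) * cos (k*x) + (b k + b' k) * sin (k*x))
    = ∑ k ∈ Finset.Icc 1 m, (a k * cos (k*x) + b k * sin (k*x))
      + ∑ k ∈ Finset.Icc 1 m, (a' k * cos (k*x) + b' k * sin (k*x)) := by
    rw [← Finset.sum_add_distrib]
    exact Finset.sum_congr rfl fun k _ => by ring
  linarith

lemma trig_smul {m : ℕ} {f : ℝ → ℝ} (c : ℝ) (hf : IsTrigPolyDeg m f) :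
    IsTrigPolyDeg m (fun x => c * f x) := by
  obtain ⟨a, b, h⟩ := hf
  refine ⟨fun k => c * a k, fun k => c * b k, fun x => ?_⟩
  simp only [h]
  rw [mul_add, Finset.mul_sum]
  congr 1
  · ring
  · exact Finset.sum_congr rfl fun k _ => by ring

lemma trig_sum {ι : Type*} {m : ℕ} (s : Finset ι) {f : ι → ℝ → ℝ}
    (hf : ∀ i ∈ s, IsTrigPolyDeg m (f i)) : IsTrigPolyDeg m (fun x => ∑ i ∈ s, f i x) := by
  classical
  induction s using Finset.induction_on with
  | empty => exact ⟨0, 0, fun x => by simp⟩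
  | insert a s ha ih =>
    simp only [Finset.sum_insert ha]
    exact trig_add (hf a (by simp)) (ih fun i hi => hf i (by simp [hi]))

lemma trig_cos {m : ℕ} (l : ℤ) (hl : l.natAbs ≤ m) (c : ℝ) :
    IsTrigPolyDeg m (fun x => cos (l * (x - c))) := by
  have key : ∀ k : ℕ, k ≤ m → IsTrigPolyDeg m (fun x => cos (k * (x - c))) := by
    intro k hk
    rcases Nat.eq_zero_or_pos k with rfl | hk0
    · exact ⟨fun k => if k = 0 then 2 else 0, 0, fun x => by
        simp only [Nat.cast_zero, zero_mul, cos_zero]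
        rw [Finset.sum_eq_zero]
        · norm_num
        · intro i hi
          rw [Finset.mem_Icc] at hi
          rw [if_neg (by omega)]; simp⟩
    · refine ⟨fun i => if i = k then cos (k*c) else 0, fun i => if i = k then sin (k*c) else 0,
        fun x => ?_⟩
      rw [Finset.sum_eq_single k]
      · simp only [if_true]
        rw [if_neg (by omega)]
        rw [mul_sub, cos_sub]; ring
      · intro i _ hi; simp [hi]
      · intro h; exact absurd (Finset.mem_Icc.2 ⟨hk0, hk⟩) h
  rcases Int.natAbs_eq l with h | h
  · have := key _ hl
    rw [h]; simpa using this
  · have := key _ hl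
    have h2 : (l:ℝ) = -(l.natAbs : ℝ) := by exact_mod_cast h
    simp only [h2, neg_mul, cos_neg]
    exact this

lemma Sop_isTrig (n : ℕ) (f : ℝ → ℝ) : IsTrigPolyDeg (n-1) (Sop n f) := by
  unfold Sop
  apply trig_smul
  refine trig_sum _ fun j _ => trig_sum _ fun l hl => trig_smul _ (trig_cos l ?_ _)
  rw [Finset.mem_Icc] at hl
  omega

lemma Sop_cont (n : ℕ) (f : ℝ → ℝ) : Continuous (Sop n f) := by
  unfold Sop; fun_prop

lemma step_bound {r : ℝ} (hr : 1 < r) {m : ℝ} (hm : 0 < m) :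
    (m+1)^(-r) ≤ (m^(1-r) - (m+1)^(1-r))/(r-1) := by
  have hk : 0 < m+1 := by linarith
  have h1 : m/(m+1) ≤ exp (-(1/(m+1))) := by
    have := Real.add_one_le_exp (-(1/(m+1)))
    refine le_trans (le_of_eq ?_) this
    field_simp; ring
  have h2 : exp (-(1/(m+1))) ^ (1-r) ≤ (m/(m+1))^(1-r) :=
    Real.rpow_le_rpow_of_nonpos (by positivity) h1 (by linarith)
  rw [← Real.exp_mul] at h2
  have h3 := Real.add_one_le_exp (-(1/(m+1)) * (1-r))
  have h4 : m^(1-r) = (m/(m+1))^(1-r) * (m+1)^(1-r) := by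
    rw [← Real.mul_rpow (by positivity) hk.le, div_mul_cancel₀ _ hk.ne']
  have h5 : (m+1)^(1-r) = (m+1) * (m+1)^(-r) := by
    rw [sub_eq_add_neg, Real.rpow_add hk, Real.rpow_one]
  have hp : 0 < (m+1)^(-r) := Real.rpow_pos_of_pos hk _
  rw [le_div_iff₀ (by linarith), h4]
  have h6 : -(1/(m+1)) * (1-r) + 1 ≤ (m/(m+1))^(1-r) := h3.trans h2
  have h7 := mul_le_mul_of_nonneg_right h6 (show 0 ≤ (m+1)^(1-r) by positivity)
  have h8 : (-(1/(m+1)) * (1-r) + 1) * (m+1)^(1-r) = (m+1)^(-r) * (r-1) + (m+1)^(1-r) := by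
    rw [h5]; field_simp; ring
  linarith

noncomputable def W (r : ℝ) (k : ℕ) : ℝ := (k:ℝ)^(-r)

lemma W_nonneg (r : ℝ) (k : ℕ) : 0 ≤ W r k := by unfold W; positivity

lemma W_summable {r : ℝ} (hr : 1 < r) (m : ℕ) : Summable (fun i => W r (i + m)) := by
  have : Summable (W r) := Real.summable_nat_rpow.2 (by linarith)
  exact (summable_nat_add_iff m).2 this

noncomputable def Tail (r : ℝ) (n : ℕ) : ℝ := ∑' i, W r (i + n + 1)

lemma Tail_nonneg (r : ℝ) (n : ℕ) : 0 ≤ Tail r n := tsum_nonneg fun _ => W_nonneg _ _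

lemma tail_bound {r : ℝ} (hr : 1 < r) (n : ℕ) (hn : 1 ≤ n) :
    Tail r n ≤ ((n:ℝ)+1)^(-r) * (1 + (n+1)/(r-1)) := by
  have hr1 : 0 < r - 1 := by linarith
  have key : ∀ M : ℕ, ∑ i ∈ Finset.range (M+1), W r (i+n+1)
      ≤ ((n:ℝ)+1)^(-r) + (((n:ℝ)+1)^(1-r) - ((n:ℝ)+1+M)^(1-r))/(r-1) := by
    intro M
    induction M with
    | zero => simp [W]
    | succ M ih =>
      rw [Finset.sum_range_succ]
      have h := step_bound hr (m := (n:ℝ)+1+M) (by positivity)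
      have h2 : W r (M+1+n+1) = ((n:ℝ)+1+M+1)^(-r) := by unfold W; push_cast; congr 1; ring
      rw [h2]
      refine (add_le_add ih h).trans (le_of_eq ?_)
      push_cast
      rw [← add_assoc]
      ring
  have hp : (0:ℝ) < n + 1 := by positivity
  have e : ((n:ℝ)+1)^(1-r) = (n+1) * ((n:ℝ)+1)^(-r) := by
    rw [sub_eq_add_neg, Real.rpow_add hp, Real.rpow_one]
  have key2 : ∀ M : ℕ, ∑ i ∈ Finset.range (M+1), W r (i+n+1)
      ≤ ((n:ℝ)+1)^(-r) * (1 + (n+1)/(r-1)) := by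
    intro M
    refine (key M).trans ?_
    have h0 : 0 ≤ ((n:ℝ)+1+M)^(1-r) := by positivity
    calc _ ≤ ((n:ℝ)+1)^(-r) + (((n:ℝ)+1)^(1-r))/(r-1) := by gcongr; linarith
      _ = _ := by rw [e]; ring
  unfold Tail
  refine Real.tsum_le_of_sum_range_le (fun i => W_nonneg _ _) (fun M => ?_)
  refine le_trans ?_ (key2 M)
  rw [Finset.sum_range_succ]
  linarith [W_nonneg r (M+n+1)]

lemma tail_bound' {r : ℝ} (hr : 1 < r) (n : ℕ) (hn : 1 ≤ n) :
    (n:ℝ)^r * Tail r n ≤ 2 * (exp (-r/((n:ℝ)+1)) * (1 + n/(r-1))) := by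
  have hn' : (1:ℝ) ≤ n := by exact_mod_cast hn
  have hr1 : 0 < r - 1 := by linarith
  have h1 : (n:ℝ)^r * ((n:ℝ)+1)^(-r) ≤ exp (-r/((n:ℝ)+1)) := by
    rw [Real.rpow_neg (by positivity), ← div_eq_mul_inv, ← Real.div_rpow (by positivity)
      (by positivity)]
    have h2 : (n:ℝ)/(n+1) ≤ exp (-(1/((n:ℝ)+1))) := by
      have := Real.add_one_le_exp (-(1/((n:ℝ)+1)))
      refine le_trans (le_of_eq ?_) this
      field_simp; ring
    calc ((n:ℝ)/(n+1))^r ≤ exp (-(1/((n:ℝ)+1)))^r :=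
          Real.rpow_le_rpow (by positivity) h2 (by linarith)
      _ = _ := by rw [← Real.exp_mul]; congr 1; ring
  have h3 : 1 + ((n:ℝ)+1)/(r-1) ≤ 2*(1 + n/(r-1)) := by
    have : ((n:ℝ)+1)/(r-1) ≤ 2*n/(r-1) := by gcongr; linarith
    have e : 2*(1 + (n:ℝ)/(r-1)) = 2 + 2*n/(r-1) := by ring
    linarith
  calc (n:ℝ)^r * Tail r n ≤ (n:ℝ)^r * (((n:ℝ)+1)^(-r) * (1 + (n+1)/(r-1))) := by
        gcongr; exact tail_bound hr n hn
    _ = (n:ℝ)^r * ((n:ℝ)+1)^(-r) * (1 + (n+1)/(r-1)) := by ring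
    _ ≤ exp (-r/((n:ℝ)+1)) * (2*(1 + n/(r-1))) := by gcongr
    _ = _ := by ring

lemma Sop_hasSum (n : ℕ) {F : ℕ → ℝ → ℝ} {f : ℝ → ℝ} (h : ∀ y, HasSum (fun k => F k y) (f y))
    (x : ℝ) : HasSum (fun k => Sop n (F k) x) (Sop n f x) := by
  unfold Sop
  apply HasSum.mul_left
  exact hasSum_sum fun j _ => hasSum_sum fun l _ => (h _).mul_right _

lemma term_bound (r : ℝ) (k : ℕ) (y : ℝ) : ‖W r k * cos y‖ ≤ W r k := by
  rw [norm_mul, Real.norm_of_nonneg (W_nonneg r k)]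
  calc _ ≤ W r k * 1 := by
        gcongr
        · exact W_nonneg r k
        · exact abs_cos_le_one y
    _ = _ := mul_one _

lemma ker_hasSum {r : ℝ} (hr : 1 < r) (β : ℕ → ℝ) (t : ℝ) :
    HasSum (fun k : ℕ => W r (k+1) * cos ((k+1 : ℝ) * t - π * β (k+1) / 2)) (ker1 (W r) β t) := by
  have : Summable (fun k : ℕ => W r (k+1) * cos ((k+1 : ℝ) * t - π * β (k+1) / 2)) :=
    Summable.of_norm_bounded (W_summable hr 1) (fun k => term_bound _ _ _)
  exact this.hasSum

lemma ker_cont {r : ℝ} (hr : 1 < r) (β : ℕ → ℝ) : Continuous (ker1 (W r) β) := by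
  unfold ker1
  exact continuous_tsum (fun k => by fun_prop) (W_summable hr 1) (fun k t => term_bound _ _ _)

lemma ker_bound {r : ℝ} (hr : 1 < r) (β : ℕ → ℝ) (t : ℝ) :
    |ker1 (W r) β t| ≤ ∑' k, W r (k+1) := by
  rw [← (ker_hasSum hr β t).tsum_eq]
  exact tsum_of_norm_bounded (W_summable hr 1).hasSum (fun k => term_bound _ _ _)

noncomputable def Err (r : ℝ) (β : ℕ → ℝ) (n : ℕ) (x t : ℝ) : ℝ :=
  ker1 (W r) β (x - t) - Sop n (fun y => ker1 (W r) β (y - t)) x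

lemma Err_hasSum {r : ℝ} (hr : 1 < r) (β : ℕ → ℝ) (n : ℕ) (hn : 1 ≤ n) (x t : ℝ) :
    HasSum (fun k : ℕ => W r (k+1) * (cos ((k+1:ℝ) * (x - t) - π * β (k+1) / 2)
      - cos (ali n (k+1) * x - ((k+1:ℝ) * t + π * β (k+1) / 2)))) (Err r β n x t) := by
  have h1 := ker_hasSum hr β (x - t)
  have h2 := Sop_hasSum n (fun y => ker_hasSum hr β (y - t)) x
  have h3 := h1.sub h2
  have e : ∀ k : ℕ, W r (k+1) * (cos ((k+1:ℝ) * (x - t) - π * β (k+1) / 2)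
      - cos (ali n (k+1) * x - ((k+1:ℝ) * t + π * β (k+1) / 2)))
      = W r (k+1) * cos ((k+1:ℝ) * (x - t) - π * β (k+1) / 2)
      - Sop n (fun y => W r (k+1) * cos ((k+1:ℝ) * (y - t) - π * β (k+1) / 2)) x := ?_
  · simp_rw [e]; exact h3
  intro k
  rw [Sop_smul, mul_sub]
  congr 2
  have := Sop_cos n hn (k+1) ((k+1:ℝ) * t + π * β (k+1) / 2) x
  rw [← this]
  congr 1
  ext y; congr 1; push_cast; ring

lemma Err_node {r : ℝ} (hr : 1 < r) (β : ℕ → ℝ) (n : ℕ) (hn : 1 ≤ n) (m : ℤ) (t : ℝ) :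
    Err r β n (2 * (m:ℝ) * π / (2 * (n:ℝ) - 1)) t = 0 := by
  have hn' : (1:ℝ) ≤ n := by exact_mod_cast hn
  have hN : ((2:ℝ)*n-1) ≠ 0 := by intro h; linarith
  refine (Err_hasSum hr β n hn _ t).unique ?_
  convert hasSum_zero using 2 with k
  obtain ⟨c, hc⟩ := ali_dvd n ((k+1 : ℕ):ℤ)
  have hc2 : ((k:ℝ)+1) = ali n (k+1) + (2*n-1)*c := by
    have : ((k:ℤ)+1) = ali n (k+1) + (2*n-1)*c := by push_cast at hc; linarith
    exact_mod_cast this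
  set x := 2 * (m:ℝ) * π / (2 * (n:ℝ) - 1) with hx
  have hx2 : (2*(n:ℝ)-1) * x = 2*m*π := by rw [hx]; field_simp
  have : ((k:ℝ)+1) * (x - t) - π * β (k+1) / 2
      = (ali n (k+1) * x - (((k:ℝ)+1) * t + π * β (k+1) / 2)) + (c*m : ℤ) * (2*π) := by
    have : ((k:ℝ)+1) * x = ali n (k+1) * x + c * (2*m*π) := by
      rw [← hx2]; nth_rewrite 1 [hc2]; ring
    push_cast
    linear_combination this
  rw [this, cos_add_int_mul_two_pi]; simp

lemma Err_main {r : ℝ} (hr : 1 < r) (β : ℕ → ℝ) (n : ℕ) (hn : 1 ≤ n) (x t : ℝ) :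
    |Err r β n x t - (-2 * W r n * (sin ((2*n-1)*x/2) * sin (x/2 - (n*t + π * β n / 2))))|
      ≤ 2 * Tail r n := by
  have h := Err_hasSum hr β n hn x t
  have h1 := h.summable.sum_add_tsum_nat_add n
  rw [h.tsum_eq] at h1
  obtain ⟨m, rfl⟩ : ∃ m, n = m + 1 := ⟨n - 1, by omega⟩
  rw [← h1, Finset.sum_range_succ, Finset.sum_eq_zero, zero_add]
  · have e1 : W r (m+1) * (cos ((m+1:ℝ) * (x - t) - π * β (m+1) / 2)
      - cos (ali (m+1) (m+1) * x - ((m+1:ℝ) * t + π * β (m+1) / 2)))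
      = -2 * W r (m+1) * (sin ((2*(m+1:ℕ)-1)*x/2) * sin (x/2 - ((m+1:ℕ)*t + π * β (m+1) / 2))) := by
      have h2 := ali_n (m+1) hn
      have h3 : (ali (m+1) (m+1) : ℝ) = -(m:ℝ) := by
        push_cast at h2; rw [h2]; push_cast; ring
      rw [h3, cos_sub_cos]
      push_cast
      rw [show (((m:ℝ) + 1) * (x - t) - π * β (m + 1) / 2 + (-(m:ℝ) * x - ((m + 1) * t + π * β (m + 1) / 2))) / 2
        = x / 2 - ((m + 1) * t + π * β (m + 1) / 2) by ring,
        show (((m:ℝ) + 1) * (x - t) - π * β (m + 1) / 2 - (-(m:ℝ) * x - ((m + 1) * t + π * β (m + 1) / 2))) / 2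
        = (2 * (m + 1) - 1) * x / 2 by ring]
      ring
    rw [e1, add_sub_cancel_left]
    have hs : HasSum (fun i => 2 * W r (i + (m+1) + 1)) (2 * Tail r (m+1)) :=
      ((W_summable hr (m+1+1)).hasSum).mul_left 2
    rw [← Real.norm_eq_abs]
    refine tsum_of_norm_bounded hs (fun i => ?_)
    rw [norm_mul, Real.norm_of_nonneg (W_nonneg r _), mul_comm]
    gcongr
    · exact W_nonneg r _
    · rw [Real.norm_eq_abs]
      refine (abs_sub (G := ℝ) _ _).trans ?_
      have ha := fun y => abs_cos_le_one y
      linarith [ha ((((i + (m+1) : ℕ):ℝ) + 1) * (x - t) - π * β (i + (m+1) + 1) / 2), ha (ali (m+1) (((i + (m+1) : ℕ):ℤ) + 1) * x -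
        ((((i + (m+1) : ℕ):ℝ) + 1) * t + π * β (i + (m+1) + 1) / 2))]
  · intro k hk
    rw [Finset.mem_range] at hk
    have h2 := ali_small (m+1) hn (k+1) (by omega)
    push_cast at h2
    rw [h2]; push_cast
    rw [show ((k:ℝ)+1)*(x-t) - π * β (k+1)/2 = (k+1)*x - ((k+1)*t + π * β (k+1)/2) by ring]
    simp

lemma adm_int {φ : ℝ → ℝ} (h : AdmPhi φ) : IntervalIntegrable φ volume 0 (2*π) := by
  rw [intervalIntegrable_iff_integrableOn_Ioc_of_le two_pi_pos.le]; exact h.2.1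

lemma int_mul_le {φ : ℝ → ℝ} (h : AdmPhi φ) {g : ℝ → ℝ} {M : ℝ} (hM : 0 ≤ M)
    (hb : ∀ t, |g t| ≤ M) : |∫ t in (0:ℝ)..(2*π), g t * φ t| ≤ M := by
  rw [← Real.norm_eq_abs]
  have h1 := intervalIntegral.norm_integral_le_of_norm_le (f := fun t => g t * φ t)
    (g := fun t => M * |φ t|) (a := 0) (b := 2*π) (μ := volume) two_pi_pos.le
    (ae_of_all _ fun t _ => by
      rw [norm_mul]; exact mul_le_mul_of_nonneg_right (hb t) (abs_nonneg _))
    ((adm_int h).abs.const_mul M)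
  refine h1.trans ?_
  rw [intervalIntegral.integral_const_mul]
  calc _ ≤ M * 1 := by gcongr; exact h.2.2.2
    _ = M := mul_one M

lemma ker_int {r : ℝ} (hr : 1 < r) (β : ℕ → ℝ) {φ : ℝ → ℝ} (h : AdmPhi φ) (x : ℝ) :
    IntervalIntegrable (fun t => ker1 (W r) β (x - t) * φ t) volume 0 (2*π) := by
  have := ker_cont hr β
  exact (adm_int h).continuousOn_mul (by fun_prop)

lemma conv_cont {r : ℝ} (hr : 1 < r) (β : ℕ → ℝ) {φ : ℝ → ℝ} (h : AdmPhi φ) :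
    Continuous (fun x => ∫ t in (0:ℝ)..(2*π), ker1 (W r) β (x - t) * φ t) := by
  have hk := ker_cont hr β
  refine intervalIntegral.continuous_of_dominated_interval
    (bound := fun t => (∑' k, W r (k+1)) * |φ t|) ?_ ?_ ?_ ?_
  · intro x
    have := (ker_int hr β h x).1.aestronglyMeasurable
    rwa [Set.uIoc_of_le two_pi_pos.le]
  · intro x
    refine ae_of_all _ fun t _ => ?_
    rw [norm_mul]; exact mul_le_mul_of_nonneg_right (ker_bound hr β _) (abs_nonneg _)
  · exact (adm_int h).abs.const_mul _
  · refine ae_of_all _ fun t _ => ?_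
    fun_prop

lemma Sop_conv {r : ℝ} (hr : 1 < r) (β : ℕ → ℝ) {φ : ℝ → ℝ} (h : AdmPhi φ) (n : ℕ) (x : ℝ) :
    IntervalIntegrable (fun t => Sop n (fun y => ker1 (W r) β (y - t)) x * φ t) volume 0 (2*π) ∧
    Sop n (fun x => ∫ t in (0:ℝ)..(2*π), ker1 (W r) β (x - t) * φ t) x
      = ∫ t in (0:ℝ)..(2*π), Sop n (fun y => ker1 (W r) β (y - t)) x * φ t := by
  have hk := ker_cont hr β
  constructor
  · refine (adm_int h).continuousOn_mul (Continuous.continuousOn ?_)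
    unfold Sop; fun_prop
  · unfold Sop
    have e : ∀ t, (1/(2*(n:ℝ)-1)) * (∑ j ∈ Finset.range (2*n-1),
        ∑ l ∈ Finset.Icc (-((n:ℤ)-1)) ((n:ℤ)-1),
        ker1 (W r) β (nd n j - t) * cos (l * (x - nd n j))) * φ t
      = (1/(2*(n:ℝ)-1)) * (∑ j ∈ Finset.range (2*n-1),
        ∑ l ∈ Finset.Icc (-((n:ℤ)-1)) ((n:ℤ)-1),
        (ker1 (W r) β (nd n j - t) * φ t) * cos (l * (x - nd n j))) := by
      intro t
      rw [mul_assoc, Finset.sum_mul]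
      congr 1
      refine Finset.sum_congr rfl fun j _ => ?_
      rw [Finset.sum_mul]
      exact Finset.sum_congr rfl fun l _ => by ring
    simp_rw [e]
    rw [intervalIntegral.integral_const_mul, intervalIntegral.integral_finsetSum]
    · congr 1
      refine Finset.sum_congr rfl fun j _ => ?_
      rw [intervalIntegral.integral_finsetSum]
      · refine Finset.sum_congr rfl fun l _ => ?_
        rw [intervalIntegral.integral_mul_const]
      · intro l _
        exact (ker_int hr β h _).mul_const _
    · intro j _
      simp_rw [← Finset.mul_sum]
      exact (ker_int hr β h _).mul_const _

lemma f_sub {r : ℝ} (hr : 1 < r) (β : ℕ → ℝ) {φ : ℝ → ℝ} (h : AdmPhi φ) (n : ℕ) (hn : 1 ≤ n)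
    {a₀ : ℝ} {f : ℝ → ℝ}
    (hf : ∀ x, f x = a₀/2 + (1/π) * ∫ t in (0:ℝ)..(2*π), ker1 (W r) β (x - t) * φ t) (x : ℝ) :
    f x - Sop n f x = (1/π) * ∫ t in (0:ℝ)..(2*π), Err r β n x t * φ t := by
  obtain ⟨h1, h2⟩ := Sop_conv hr β h n x
  have e : Sop n f x = a₀/2 + (1/π) *
      ∫ t in (0:ℝ)..(2*π), Sop n (fun y => ker1 (W r) β (y - t)) x * φ t := by
    rw [← h2, funext hf, Sop_add, Sop_const n hn, Sop_smul]
  rw [e, hf x]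
  unfold Err
  simp_rw [sub_mul]
  rw [intervalIntegral.integral_sub (ker_int hr β h x) h1]
  ring

lemma class_interp {r : ℝ} (hr : 1 < r) (β : ℕ → ℝ) {φ : ℝ → ℝ} (h : AdmPhi φ) (n : ℕ)
    (hn : 1 ≤ n) {a₀ : ℝ} {f : ℝ → ℝ}
    (hf : ∀ x, f x = a₀/2 + (1/π) * ∫ t in (0:ℝ)..(2*π), ker1 (W r) β (x - t) * φ t) :
    InterpolatesAt n (Sop n f) f := by
  refine ⟨Sop_isTrig n f, fun k => ?_⟩
  have := f_sub hr β h n hn hf (2 * (k:ℝ) * π / (2 * (n:ℝ) - 1))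
  simp only [Err_node hr β n hn, zero_mul, intervalIntegral.integral_zero, mul_zero] at this
  linarith

lemma approx {r : ℝ} (hr : 1 < r) (β : ℕ → ℝ) {φ : ℝ → ℝ} (h : AdmPhi φ) (n : ℕ)
    (hn : 1 ≤ n) {a₀ : ℝ} {f : ℝ → ℝ}
    (hf : ∀ x, f x = a₀/2 + (1/π) * ∫ t in (0:ℝ)..(2*π), ker1 (W r) β (x - t) * φ t)
    {ρ c : ℝ} (hρ : 0 ≤ ρ)
    (hG : ∀ x : ℝ, ∫ t in (0:ℝ)..(2*π), sin (x/2 - (n*t + π * β n / 2)) * φ t = ρ * sin (x/2 - c))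
    {p : ℝ≥0∞} (hp : 1 ≤ p) :
    |LpNormPer p (fun x => f x - Sop n f x) - 2/π * W r n * ρ * LpNormPer p (prof n c)|
      ≤ 4 * Tail r n := by
  have hk := ker_cont hr β
  have hfc : Continuous (fun x => f x - Sop n f x) := by
    have := Sop_cont n f
    have h2 : Continuous f := by
      rw [funext hf]; have := conv_cont hr β h; fun_prop
    fun_prop
  have hW := W_nonneg r n
  have hT := Tail_nonneg r n
  set K := -(2/π * W r n * ρ) with hK
  have hKabs : |K| = 2/π * W r n * ρ := by rw [hK, abs_neg, abs_of_nonneg (by positivity)]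
  have hpt : ∀ x, |(f x - Sop n f x) - K * prof n c x| ≤ 2/π * Tail r n := by
    intro x
    rw [f_sub hr β h n hn hf x]
    have hErrc : Continuous (fun t => Err r β n x t) := by
      unfold Err Sop; fun_prop
    have e : K * prof n c x = (1/π) * ∫ t in (0:ℝ)..(2*π),
        (-2 * W r n * (sin ((2*n-1)*x/2) * sin (x/2 - (n*t + π * β n / 2)))) * φ t := by
      have : ∀ t, (-2 * W r n * (sin ((2*n-1)*x/2) * sin (x/2 - (n*t + π * β n / 2)))) * φ t
        = (-2 * W r n * sin ((2*n-1)*x/2)) * (sin (x/2 - (n*t + π * β n / 2)) * φ t) :=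
        fun t => by ring
      simp_rw [this]
      rw [intervalIntegral.integral_const_mul, hG, hK, prof]
      ring
    rw [e, ← mul_sub, ← intervalIntegral.integral_sub]
    · simp_rw [← sub_mul]
      rw [abs_mul, abs_of_pos (by positivity)]
      have := int_mul_le h (by positivity) (fun t => Err_main hr β n hn x t)
      calc _ ≤ 1/π * (2 * Tail r n) := by gcongr
        _ = _ := by ring
    · exact (adm_int h).continuousOn_mul hErrc.continuousOn
    · exact (adm_int h).continuousOn_mul (by fun_prop)
  have hpc : Continuous (fun x => K * prof n c x) := by have := prof_cont n c; fun_prop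
  have hs := LpNormPer_smul (p := p) (f := prof n c) K
  rw [hKabs] at hs
  have h1 := LpNormPer_close hp hfc hpc (by positivity) hpt
  have h2 := LpNormPer_close hp hpc hfc (M := 2/π * Tail r n) (by positivity)
    (fun x => by rw [abs_sub_comm]; exact hpt x)
  rw [hs] at h1 h2
  have e2 : 2*π*(2/π * Tail r n) = 4 * Tail r n := by field_simp; ring
  rw [e2] at h1 h2
  rw [abs_le]; constructor <;> linarith

lemma upper_struct {φ : ℝ → ℝ} (h : AdmPhi φ) (n : ℕ) (γ : ℝ) :
    ∃ ρ c : ℝ, 0 ≤ ρ ∧ ρ ≤ 1 ∧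
      ∀ x : ℝ, ∫ t in (0:ℝ)..(2*π), sin (x/2 - (n*t + γ)) * φ t = ρ * sin (x/2 - c) := by
  have hi := adm_int h
  set a := ∫ t in (0:ℝ)..(2*π), cos (n*t + γ) * φ t with ha
  set b := ∫ t in (0:ℝ)..(2*π), sin (n*t + γ) * φ t with hb
  have lin : ∀ u v : ℝ, ∫ t in (0:ℝ)..(2*π), (u * cos (n*t + γ) + v * sin (n*t+γ)) * φ t
      = u * a + v * b := by
    intro u v
    have : ∀ t, (u * cos (n*t + γ) + v * sin (n*t+γ)) * φ t
      = u * (cos (n*t + γ) * φ t) + v * (sin (n*t+γ) * φ t) := fun t => by ring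
    simp_rw [this]
    rw [intervalIntegral.integral_add, intervalIntegral.integral_const_mul,
      intervalIntegral.integral_const_mul]
    · exact (hi.continuousOn_mul (by fun_prop)).const_mul _
    · exact (hi.continuousOn_mul (by fun_prop)).const_mul _
  set z : ℂ := ⟨a, b⟩ with hz
  set c := Complex.arg z with hc
  have h1 : ‖z‖ * cos c = a := Complex.norm_mul_cos_arg z
  have h2 : ‖z‖ * sin c = b := Complex.norm_mul_sin_arg z
  refine ⟨‖z‖, c, norm_nonneg _, ?_, ?_⟩
  · have h3 : ‖z‖ = cos c * a + sin c * b := by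
      rw [← h1, ← h2]; linear_combination (-‖z‖) * (sin_sq_add_cos_sq c)
    rw [h3, ← lin]
    refine (le_abs_self _).trans (int_mul_le h zero_le_one fun t => ?_)
    have : cos c * cos (n*t + γ) + sin c * sin (n*t+γ) = cos (c - (n*t+γ)) := (cos_sub _ _).symm
    rw [this]; exact abs_cos_le_one _
  · intro x
    have : ∀ t, sin (x/2 - (n*t + γ)) = sin (x/2) * cos (n*t+γ) + (-cos (x/2)) * sin (n*t+γ) :=
      fun t => by rw [sin_sub]; ring
    simp_rw [this]
    rw [lin, ← h1, ← h2, sin_sub]; ring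

lemma per_int (n : ℕ) (hn : 1 ≤ n) (δ : ℝ) {g : ℝ → ℝ} (hg : Continuous g)
    (hp : Function.Periodic g (2*π)) :
    ∫ t in (0:ℝ)..(2*π), g (n*t + δ) = ∫ t in (0:ℝ)..(2*π), g t := by
  have hn0 : (n:ℝ) ≠ 0 := by positivity
  rw [intervalIntegral.integral_comp_mul_add g hn0]
  have := hp.intervalIntegral_add_zsmul_eq n δ (fun _ _ => hg.intervalIntegrable _ _)
  rw [hp.intervalIntegral_add_eq δ 0] at this
  simp only [zsmul_eq_mul, zero_add, Int.cast_natCast] at this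
  rw [mul_zero, zero_add, add_comm, this, smul_eq_mul]
  field_simp

lemma cos_red (k : ℕ) : ∫ t in (0:ℝ)..(2*π), cos t ^ (k+2)
    = (k+1)/(k+2) * ∫ t in (0:ℝ)..(2*π), cos t ^ k := by
  rw [integral_cos_pow]; simp

lemma cos_odd (m : ℕ) : ∫ t in (0:ℝ)..(2*π), cos t ^ (2*m+1) = 0 := by
  induction m with
  | zero => simp
  | succ m ih => rw [show 2*(m+1)+1 = (2*m+1)+2 by ring, cos_red, ih, mul_zero]

lemma cos_even_pos (m : ℕ) : 0 < ∫ t in (0:ℝ)..(2*π), cos t ^ (2*m) := by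
  induction m with
  | zero => simp [pi_pos]
  | succ m ih => rw [show 2*(m+1) = (2*m)+2 by ring, cos_red]; positivity

lemma sin_cos_zero (k : ℕ) : ∫ t in (0:ℝ)..(2*π), sin t * cos t ^ k = 0 := by
  have h := intervalIntegral.integral_comp_sub_left (a := 0) (b := 2*π)
    (fun t => sin t * cos t ^ k) (2*π)
  simp only [sin_two_pi_sub, cos_two_pi_sub, sub_self, sub_zero, neg_mul,
    intervalIntegral.integral_neg] at h
  linarith

lemma lower_struct (n : ℕ) (hn : 1 ≤ n) (γ c : ℝ) :
    ∃ (φ : ℝ → ℝ) (ρ : ℝ), AdmPhi φ ∧ 1 - 1/(n:ℝ) ≤ ρ ∧ 0 ≤ ρ ∧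
      ∀ x : ℝ, ∫ t in (0:ℝ)..(2*π), sin (x/2 - (n*t + γ)) * φ t = ρ * sin (x/2 - c) := by
  set δ := γ - c with hδ
  set K := ∫ t in (0:ℝ)..(2*π), |cos t| ^ (2*n+1) with hK
  set I2 := ∫ t in (0:ℝ)..(2*π), cos t ^ (2*n+2) with hI2
  set I0 := ∫ t in (0:ℝ)..(2*π), cos t ^ (2*n) with hI0
  have hI0pos : 0 < I0 := cos_even_pos n
  have hI2pos : 0 < I2 := cos_even_pos (n+1)
  have hred : I2 = (2*n+1)/(2*n+2) * I0 := by
    rw [hI2, hI0, cos_red]; push_cast; rfl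
  have habs : ∀ t, |cos t| ^ (2*n) = cos t ^ (2*n) := fun t => by
    rw [pow_mul, sq_abs, ← pow_mul]
  have hKI0 : K ≤ I0 := by
    apply intervalIntegral.integral_mono_on two_pi_pos.le
    · exact Continuous.intervalIntegrable (by fun_prop) _ _
    · exact Continuous.intervalIntegrable (by fun_prop) _ _
    · intro t _
      rw [← habs, pow_succ]
      exact mul_le_of_le_one_right (by positivity) (abs_cos_le_one t)
  have hI2K : I2 ≤ K := by
    apply intervalIntegral.integral_mono_on two_pi_pos.le
    · exact Continuous.intervalIntegrable (by fun_prop) _ _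
    · exact Continuous.intervalIntegrable (by fun_prop) _ _
    · intro t _
      rw [show 2*n+2 = 2*(n+1) by ring, pow_mul, ← sq_abs, ← pow_mul,
        show 2*(n+1) = (2*n+1)+1 by ring, pow_succ _ (2*n+1)]
      exact mul_le_of_le_one_right (by positivity) (abs_cos_le_one t)
  have hKpos : 0 < K := lt_of_lt_of_le hI2pos hI2K
  refine ⟨fun t => K⁻¹ * cos (n*t + δ) ^ (2*n+1), K⁻¹ * I2, ⟨?_, ?_, ?_, ?_⟩, ?_, by positivity, ?_⟩
  · intro t
    show K⁻¹ * cos (n*(t+2*π)+δ)^(2*n+1) = K⁻¹ * cos (n*t+δ)^(2*n+1)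
    rw [show (n:ℝ)*(t+2*π)+δ = (n*t+δ) + n*(2*π) by ring, cos_add_nat_mul_two_pi]
  · refine IntegrableOn.mono_set (t := Icc 0 (2*π)) ?_ Ioc_subset_Icc_self
    exact Continuous.integrableOn_Icc (by fun_prop)
  · rw [intervalIntegral.integral_const_mul,
      per_int n hn δ (g := fun t => cos t ^ (2*n+1)) (by fun_prop)
        (fun t => by simp), cos_odd, mul_zero]
  · simp_rw [abs_mul, abs_of_pos (inv_pos.2 hKpos), abs_pow]
    rw [intervalIntegral.integral_const_mul,
      per_int n hn δ (g := fun t => |cos t| ^ (2*n+1)) (by fun_prop)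
        (fun t => by simp), ← hK, inv_mul_cancel₀ hKpos.ne']
  · have hn' : (1:ℝ) ≤ n := by exact_mod_cast hn
    have h1 : (2*(n:ℝ)+1)/(2*n+2) ≤ K⁻¹ * I2 := by
      rw [inv_mul_eq_div, le_div_iff₀ hKpos, hred]
      gcongr
    refine le_trans ?_ h1
    rw [le_div_iff₀ (by positivity)]
    have : (1 - 1/(n:ℝ)) * (2*n+2) = 2*n - 2/n := by field_simp; ring
    rw [this]
    have : (0:ℝ) ≤ 2/n := by positivity
    linarith
  · intro x
    have e : ∀ t, sin (x/2 - (n*t + γ)) * (K⁻¹ * cos (n*t + δ) ^ (2*n+1))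
        = (K⁻¹ * sin (x/2 - c)) * cos (n*t+δ) ^ (2*n+2)
          - (K⁻¹ * cos (x/2 - c)) * (sin (n*t+δ) * cos (n*t+δ)^(2*n+1)) := by
      intro t
      rw [show x/2 - (n*t+γ) = (x/2 - c) - (n*t+δ) by rw [hδ]; ring, sin_sub]; ring
    simp_rw [e]
    rw [intervalIntegral.integral_sub (Continuous.intervalIntegrable (by fun_prop) _ _)
      (Continuous.intervalIntegrable (by fun_prop) _ _), intervalIntegral.integral_const_mul,
      intervalIntegral.integral_const_mul,
      per_int n hn δ (g := fun t => cos t ^ (2*n+2)) (by fun_prop) (fun t => by simp),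
      per_int n hn δ (g := fun t => sin t * cos t ^ (2*n+1)) (by fun_prop) (fun t => by simp),
      sin_cos_zero]
    ring

/-- **Theorem 3.** For the Weyl–Nagy classes `W^r_{β̄,1}` (`ψ(k) = k^{−r}`, `r > 1`):
`|n^r Ẽ_n(W^r_{β̄,1})_{L_p} − (2^{1−1/p}/π^{1+1/p})‖cos‖_p²| ≤ C(1/n + e^{−r/(n+1)}(1 + n/(r−1)))`. -/
theorem statement3 :
    ∃ C : ℝ, 0 < C ∧ ∀ (p : ℝ≥0∞), 1 ≤ p → ∀ (r : ℝ), 1 < r → ∀ (βb : ℕ → ℝ),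
      ∀ n : ℕ, 1 ≤ n →
        |(n:ℝ) ^ r * interpErr p n (ClassC (fun k : ℕ => (k:ℝ) ^ (-r)) βb) -
            2 ^ ((1:ℝ) - 1/p.toReal) / π ^ ((1:ℝ) + 1/p.toReal) * (cosLp p) ^ 2| ≤
          C * (1/n + Real.exp (-r / ((n:ℝ)+1)) * (1 + (n:ℝ) / (r-1))) := by

  refine ⟨16, by norm_num, ?_⟩
  intro p hp r hr β n hn
  have hn' : (1:ℝ) ≤ n := by exact_mod_cast hn
  have hn0 : (0:ℝ) < n := by linarith
  rw [Aconst_eq]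
  change |(n:ℝ) ^ r * interpErr p n (ClassC (W r) β) - 2/π * Aconst p| ≤ _
  have hT := tail_bound' hr n hn
  set B := exp (-r / ((n:ℝ)+1)) * (1 + (n:ℝ) / (r-1)) with hB
  have hnr : 0 < (n:ℝ)^r := by positivity
  have hW : (n:ℝ)^r * W r n = 1 := by
    unfold W; rw [← Real.rpow_add hn0]; simp
  have hup : ∀ e ∈ { e : ℝ | ∃ f ∈ ClassC (W r) β, ∃ T : ℝ → ℝ, InterpolatesAt n T f ∧
      e = LpNormPer p (fun x => f x - T x) },
      e ≤ ((n:ℝ)^r)⁻¹ * (2/π * Aconst p + 16 * (1/n + B)) := by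
    rintro e ⟨f, ⟨a₀, φ, hφ, hf⟩, T, hT', rfl⟩
    have hTS : T = Sop n f := funext (interp_eq n hn hT')
    rw [hTS]
    obtain ⟨ρ, c, hρ0, hρ1, hG⟩ := upper_struct hφ n (π * β n / 2)
    have h1 := approx hr β hφ n hn hf hρ0 hG hp
    have h2 := prof_upper hp hn c
    have h3 := (abs_le.1 h1).2
    set L := LpNormPer p (fun x => f x - Sop n f x)
    rw [inv_mul_eq_div, le_div_iff₀ hnr]
    have h4 : (n:ℝ)^r * L ≤ 2/π * ρ * LpNormPer p (prof n c) + 4 * ((n:ℝ)^r * Tail r n) := by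
      have h5 : L ≤ 2/π * W r n * ρ * LpNormPer p (prof n c) + 4 * Tail r n := by linarith
      calc (n:ℝ)^r * L ≤ (n:ℝ)^r * (2/π * W r n * ρ * LpNormPer p (prof n c) + 4 * Tail r n) := by
            gcongr
        _ = ((n:ℝ)^r * W r n) * (2/π * ρ * LpNormPer p (prof n c)) + 4 * ((n:ℝ)^r * Tail r n) := by
            ring
        _ = _ := by rw [hW, one_mul]
    have h6 : 2/π * ρ * LpNormPer p (prof n c) ≤ 2/π * (Aconst p + 2*π*(π/n)) := by
      have := LpNormPer_nonneg p (prof n c)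
      calc _ ≤ 2/π * 1 * LpNormPer p (prof n c) := by gcongr
        _ = 2/π * LpNormPer p (prof n c) := by ring
        _ ≤ _ := by gcongr
    have h7 : 2/π * (Aconst p + 2*π*(π/n)) = 2/π * Aconst p + (4*π) * (1/n) := by
      field_simp; ring
    have h8 : (4*π) * (1/(n:ℝ)) ≤ 16 * (1/n) := by
      gcongr; linarith [pi_le_four]
    have hB0 : 0 ≤ B := by
      have : 0 < r - 1 := by linarith
      positivity
    linarith
  obtain ⟨c, hc⟩ := exists_prof hp hn
  obtain ⟨φ, ρ, hφ, hρ1, hρ0, hG⟩ := lower_struct n hn (π * β n / 2) c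
  set f : ℝ → ℝ := fun x => (0:ℝ)/2 + (1/π) * ∫ t in (0:ℝ)..(2*π), ker1 (W r) β (x - t) * φ t with hfd
  have hf : ∀ x, f x = (0:ℝ)/2 + (1/π) * ∫ t in (0:ℝ)..(2*π), ker1 (W r) β (x - t) * φ t :=
    fun x => rfl
  have hmem : LpNormPer p (fun x => f x - Sop n f x) ∈
      { e : ℝ | ∃ f ∈ ClassC (W r) β, ∃ T : ℝ → ℝ, InterpolatesAt n T f ∧
      e = LpNormPer p (fun x => f x - T x) } :=
    ⟨f, ⟨0, φ, hφ, hf⟩, Sop n f, class_interp hr β hφ n hn hf, rfl⟩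
  have hlow := (abs_le.1 (approx hr β hφ n hn hf hρ0 hG hp)).1
  set L := LpNormPer p (fun x => f x - Sop n f x)
  have hs1 : interpErr p n (ClassC (W r) β) ≤ ((n:ℝ)^r)⁻¹ * (2/π * Aconst p + 16 * (1/n + B)) :=
    csSup_le ⟨L, hmem⟩ hup
  have hs2 : L ≤ interpErr p n (ClassC (W r) β) := le_csSup ⟨_, hup⟩ hmem
  rw [abs_le]
  constructor
  · have h1 : (n:ℝ)^r * L ≤ (n:ℝ)^r * interpErr p n (ClassC (W r) β) := by gcongr
    have h2 : 2/π * ρ * LpNormPer p (prof n c) - 4 * ((n:ℝ)^r * Tail r n) ≤ (n:ℝ)^r * L := by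
      have h5 : 2/π * W r n * ρ * LpNormPer p (prof n c) - 4 * Tail r n ≤ L := by linarith
      calc _ = ((n:ℝ)^r * W r n) * (2/π * ρ * LpNormPer p (prof n c)) - 4 * ((n:ℝ)^r * Tail r n) := by
            rw [hW, one_mul]
        _ = (n:ℝ)^r * (2/π * W r n * ρ * LpNormPer p (prof n c) - 4 * Tail r n) := by ring
        _ ≤ _ := by gcongr
    have hA0 := Aconst_nonneg p
    have h3 : 2/π * ((1 - 1/n) * Aconst p) ≤ 2/π * ρ * LpNormPer p (prof n c) := by
      rw [mul_assoc]
      gcongr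
    have h4 : 2/π * ((1 - 1/n) * Aconst p) = 2/π * Aconst p - (2/π * Aconst p) * (1/n) := by ring
    have h5 : 2/π * Aconst p ≤ 4 := by
      have := Aconst_le hp
      rw [div_mul_eq_mul_div, div_le_iff₀ pi_pos]; linarith
    have h6 : (2/π * Aconst p) * (1/(n:ℝ)) ≤ 4 * (1/n) := by gcongr
    have : (0:ℝ) ≤ 1/n := by positivity
    have hB0 : 0 ≤ B := by
      have : 0 < r - 1 := by linarith
      positivity
    linarith
  · rw [inv_mul_eq_div, le_div_iff₀ hnr] at hs1
    linarith
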